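/- Suppose the tiling g is obtained from the tiling f by a GD flip. Then for each offset t ∈ {(0,0), (1,0), (0,1)}, the number of downward unit triangles d = (i,j) with g(d) = (i+t₁, j+t₂) equals the number of downward unit triangles d = (i,j) with f(d) = (i+t₁, j+t₂) (the number of rhombi of each of the three orientations is preserved); moreover, the sum of 2i + j over all downward triangles d = (i,j) with g(d) = (i,j+1) (the vertical rhombi of g) is strictly greater than the sum of 2i + j over all downward triangles d = (i,j) with f(d) = (i,j+1). -/

import Mathlib

/-- The upward unit triangles of the side-`n` triangle Δ: pairs `(i,j)` with `i+j ≤ n-1`. -/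
def UpTri (n : ℕ) : Set (ℕ × ℕ) := {p | p.1 + p.2 + 1 ≤ n}

/-- The downward unit triangles of Δ: pairs `(i,j)` with `i+j ≤ n-2`. -/
def DownTri (n : ℕ) : Set (ℕ × ℕ) := {p | p.1 + p.2 + 2 ≤ n}

/-- The downward unit triangle `d` is adjacent to exactly the upward unit triangles
`d`, `(d.1+1, d.2)` and `(d.1, d.2+1)`. -/
def Adj (d u : ℕ × ℕ) : Prop :=
  u = d ∨ u = (d.1 + 1, d.2) ∨ u = (d.1, d.2 + 1)

/-- A fine mixed subdivision (tiling) of Δ with hole set `S`: a bijection `f` from the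
downward unit triangles onto the upward unit triangles not in `S`, with `f d` adjacent
to `d` for every `d`. -/
def IsTiling (n : ℕ) (S : Set (ℕ × ℕ)) (f : ℕ × ℕ → ℕ × ℕ) : Prop :=
  Set.BijOn f (DownTri n) (UpTri n \ S) ∧ ∀ d ∈ DownTri n, Adj d (f d)

/-- The upward unit triangles of the upward subtriangle `T(a,b,k)`. -/
def UpCells (a b k : ℕ) : Set (ℕ × ℕ) :=
  {p | a ≤ p.1 ∧ b ≤ p.2 ∧ p.1 + p.2 + 1 ≤ a + b + k}

/-- The downward unit triangles of the upward subtriangle `T(a,b,k)`. -/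
def DownCells (a b k : ℕ) : Set (ℕ × ℕ) :=
  {p | a ≤ p.1 ∧ b ≤ p.2 ∧ p.1 + p.2 + 2 ≤ a + b + k}

/-- `S` is spread-out: every upward subtriangle of size `k` contains at most `k` holes. -/
def SpreadOut (n : ℕ) (S : Finset (ℕ × ℕ)) : Prop :=
  ∀ a b k : ℕ, a + b + k ≤ n →
    (S.filter (fun p => a ≤ p.1 ∧ b ≤ p.2 ∧ p.1 + p.2 + 1 ≤ a + b + k)).card ≤ k

/-- The upward unit triangles of the GD ring `R(a,b,m)`: upward cells of `T(a,b,m)` other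
than the three corners and the cells of the central subtriangle `T(a+1,b+1,m-3)`. -/
def RingUp (a b m : ℕ) : Set (ℕ × ℕ) :=
  UpCells a b m \ ({(a, b), (a + m - 1, b), (a, b + m - 1)} ∪ UpCells (a + 1) (b + 1) (m - 3))

/-- The downward unit triangles of the GD ring `R(a,b,m)`. -/
def RingDown (a b m : ℕ) : Set (ℕ × ℕ) :=
  DownCells a b m \ DownCells (a + 1) (b + 1) (m - 3)

/-- `f` contains a clockwise GD at `(a,b,m)`. -/
def CWGD (f : ℕ × ℕ → ℕ × ℕ) (a b m : ℕ) : Prop :=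
  f '' RingDown a b m = RingUp a b m ∧ f (a, b) = (a, b + 1)

/-- `f` contains a counterclockwise GD at `(a,b,m)`. -/
def CCWGD (f : ℕ × ℕ → ℕ × ℕ) (a b m : ℕ) : Prop :=
  f '' RingDown a b m = RingUp a b m ∧ f (a, b) = (a + 1, b)

/-- `g` is obtained from `f` by a GD flip at `(a,b,m)`. -/
def GDFlipAt (n : ℕ) (f g : ℕ × ℕ → ℕ × ℕ) (a b m : ℕ) : Prop :=
  3 ≤ m ∧ a + b + m ≤ n ∧ CWGD f a b m ∧ CCWGD g a b m ∧
    (∃ S : Set (ℕ × ℕ), IsTiling n S f ∧ IsTiling n S g) ∧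
    ∀ d ∈ DownTri n, d ∉ RingDown a b m → g d = f d

/-- `g` is obtained from `f` by a GD flip (at some position). -/
def GDFlip (n : ℕ) (f g : ℕ × ℕ → ℕ × ℕ) : Prop :=
  ∃ a b m, GDFlipAt n f g a b m

/-- The downward unit triangles of Δ, as a finset. -/
def downFinset (n : ℕ) : Finset (ℕ × ℕ) :=
  (Finset.range n ×ˢ Finset.range n).filter (fun p => p.1 + p.2 + 2 ≤ n)

/-- Coordinates of a downward cell in the ring, with `L = m - 2`. -/
def RD (a b L i j : ℕ) : Prop :=
  a ≤ i ∧ b ≤ j ∧ i + j ≤ a + b + L ∧ (i = a ∨ j = b ∨ i + j = a + b + L)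

/-- Coordinates of an upward cell in the ring, with `L = m - 2`. -/
def RU (a b L i j : ℕ) : Prop :=
  a ≤ i ∧ b ≤ j ∧ i + j ≤ a + b + L + 1 ∧ (i = a ∨ j = b ∨ i + j = a + b + L + 1) ∧
    ¬ (i = a ∧ j = b) ∧ ¬ (i = a + L + 1 ∧ j = b) ∧ ¬ (i = a ∧ j = b + L + 1)

lemma mem_ringDown (a b L i j : ℕ) (hL : 1 ≤ L) :
    (i, j) ∈ RingDown a b (L + 2) ↔ RD a b L i j := by
  simp only [RingDown, DownCells, Set.mem_sdiff, Set.mem_ofPred_eq, RD]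
  omega

lemma mem_ringUp (a b L i j : ℕ) (hL : 1 ≤ L) :
    (i, j) ∈ RingUp a b (L + 2) ↔ RU a b L i j := by
  simp only [RingUp, UpCells, Set.mem_sdiff, Set.mem_ofPred_eq, RU, Set.mem_union,
    Set.mem_insert_iff, Set.mem_singleton_iff, Prod.mk.injEq]
  omega

/-- The clockwise matching of the ring is forced. -/
lemma cw_forced (a b L : ℕ) (hL : 1 ≤ L) (f : ℕ × ℕ → ℕ × ℕ)
    (hadj : ∀ i j, RD a b L i j → f (i, j) = (i, j) ∨ f (i, j) = (i + 1, j) ∨ f (i, j) = (i, j + 1))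
    (hup : ∀ i j u v, RD a b L i j → f (i, j) = (u, v) → RU a b L u v)
    (hinj : ∀ i j i' j', RD a b L i j → RD a b L i' j' → f (i, j) = f (i', j') → i = i' ∧ j = j')
    (h0 : f (a, b) = (a, b + 1)) :
    (∀ k, k < L → f (a, b + k) = (a, b + k + 1)) ∧
    (∀ i j, i < L → i + j = L → f (a + i, b + j) = (a + i + 1, b + j)) ∧
    (∀ j i, 1 ≤ i → i + j = L → f (a + i, b) = (a + i, b)) := by
  have A : ∀ k, k < L → f (a, b + k) = (a, b + k + 1) := by
    intro k
    induction k with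
    | zero => intro _; exact h0
    | succ k ih =>
      intro hk
      have e := ih (by omega)
      have r1 : RD a b L a (b + k) := by unfold RD; omega
      have r2 : RD a b L a (b + (k + 1)) := by unfold RD; omega
      rcases hadj _ _ r2 with h | h | h
      · have := hinj _ _ _ _ r1 r2 (by rw [e, h]; rfl)
        omega
      · have := hup _ _ _ _ r2 h
        unfold RU at this; omega
      · exact h
  have B : ∀ i j, i < L → i + j = L → f (a + i, b + j) = (a + i + 1, b + j) := by
    intro i
    induction i with
    | zero =>
      intro j _ hj
      obtain rfl : j = L := by omega
      have e := A (j - 1) (by omega)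
      have r1 : RD a b j a (b + (j - 1)) := by unfold RD; omega
      have r2 : RD a b j a (b + j) := by unfold RD; omega
      rcases hadj _ _ r2 with h | h | h
      · have := hinj _ _ _ _ r1 r2 (by rw [e, h]; congr 1; omega)
        omega
      · exact h
      · have := hup _ _ _ _ r2 h
        unfold RU at this; omega
    | succ i ih =>
      intro j hi hj
      have e := ih (j + 1) (by omega) (by omega)
      have r1 : RD a b L (a + i) (b + (j + 1)) := by unfold RD; omega
      have r2 : RD a b L (a + (i + 1)) (b + j) := by unfold RD; omega
      rcases hadj _ _ r2 with h | h | h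
      · have := hup _ _ _ _ r2 h
        unfold RU at this; omega
      · exact h
      · have := hinj _ _ _ _ r1 r2 (by rw [e, h]; rfl)
        omega
  refine ⟨A, B, ?_⟩
  intro j
  induction j with
  | zero =>
    intro i _ hi
    obtain rfl : i = L := by omega
    have e := B (i - 1) 1 (by omega) (by omega)
    have r1 : RD a b i (a + (i - 1)) (b + 1) := by unfold RD; omega
    have r2 : RD a b i (a + i) b := by unfold RD; omega
    rcases hadj _ _ r2 with h | h | h
    · exact h
    · have := hup _ _ _ _ r2 h
      unfold RU at this; omega
    · have := hinj _ _ _ _ r1 r2 (by rw [e, h]; congr 1; omega)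
      omega
  | succ j ih =>
    intro i hi hj
    have e := ih (i + 1) (by omega) (by omega)
    have r1 : RD a b L (a + (i + 1)) b := by unfold RD; omega
    have r2 : RD a b L (a + i) b := by unfold RD; omega
    rcases hadj _ _ r2 with h | h | h
    · exact h
    · have := hinj _ _ _ _ r1 r2 (by rw [e, h]; rfl)
      omega
    · have := hup _ _ _ _ r2 h
      unfold RU at this; omega

/-- The counterclockwise matching of the ring is forced (by reflection). -/
lemma ccw_forced (a b L : ℕ) (hL : 1 ≤ L) (f : ℕ × ℕ → ℕ × ℕ)
    (hadj : ∀ i j, RD a b L i j → f (i, j) = (i, j) ∨ f (i, j) = (i + 1, j) ∨ f (i, j) = (i, j + 1))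
    (hup : ∀ i j u v, RD a b L i j → f (i, j) = (u, v) → RU a b L u v)
    (hinj : ∀ i j i' j', RD a b L i j → RD a b L i' j' → f (i, j) = f (i', j') → i = i' ∧ j = j')
    (h0 : f (a, b) = (a + 1, b)) :
    (∀ k, k < L → f (a + k, b) = (a + k + 1, b)) ∧
    (∀ j i, j < L → j + i = L → f (a + i, b + j) = (a + i, b + j + 1)) ∧
    (∀ i j, 1 ≤ j → j + i = L → f (a, b + j) = (a, b + j)) := by
  have sw : ∀ i j, RD b a L i j → RD a b L j i := by
    intro i j; unfold RD; omega
  have key : ∀ i j u v, (f (j, i)).swap = (u, v) ↔ f (j, i) = (v, u) := by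
    intro i j u v
    constructor
    · intro h; rw [← Prod.swap_swap (f (j, i)), h]; rfl
    · intro h; rw [h]; rfl
  have := cw_forced b a L hL (fun p => (f p.swap).swap)
    (by
      intro i j h
      simp only [Prod.swap_prod_mk, key]
      have := hadj _ _ (sw _ _ h)
      tauto)
    (by
      intro i j u v h
      simp only [Prod.swap_prod_mk, key]
      intro h'
      have := hup _ _ _ _ (sw _ _ h) h'
      unfold RU at *; omega)
    (by
      intro i j i' j' h h' e
      simp only [Prod.swap_prod_mk] at e
      have := hinj _ _ _ _ (sw _ _ h) (sw _ _ h') (Prod.swap_injective e)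
      omega)
    (by simp only [Prod.swap_prod_mk, key]; exact h0)
  simpa only [Prod.swap_prod_mk, key] using this

/-- Splitting a filter into a common part and an explicitly parametrised part. -/
lemma split_sum (D : Finset (ℕ × ℕ)) (P : ℕ × ℕ → Prop) [DecidablePred P] (R : ℕ × ℕ → Prop)
    [DecidablePred R] (L : ℕ) (p : ℕ → ℕ × ℕ) (hp : ∀ k < L, ∀ l < L, p k = p l → k = l)
    (hR : ∀ d, (d ∈ D ∧ R d ∧ P d) ↔ ∃ k < L, p k = d) (w : ℕ × ℕ → ℕ) :
    (D.filter P).sum w =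
      ((D.filter (fun d => ¬ R d)).filter P).sum w + ∑ k ∈ Finset.range L, w (p k) := by
  have h1 : D.filter P = (D.filter (fun d => ¬ R d)).filter P ∪ (Finset.range L).image p := by
    ext d
    have := hR d
    simp only [Finset.mem_filter, Finset.mem_union, Finset.mem_image, Finset.mem_range]
    rw [← this]; tauto
  rw [h1, Finset.sum_union, Finset.sum_image]
  · intro k hk l hl h
    simp only [Finset.coe_range, Set.mem_Iio] at hk hl
    exact hp k hk l hl h
  · rw [Finset.disjoint_left]
    intro d hd
    have := hR d
    simp only [Finset.mem_filter, Finset.mem_image, Finset.mem_range] at hd ⊢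
    rw [← this]; tauto

lemma mem_downFinset (n i j : ℕ) : (i, j) ∈ downFinset n ↔ i + j + 2 ≤ n := by
  simp only [downFinset, Finset.mem_filter, Finset.mem_product, Finset.mem_range]
  omega

/-- Extracting the abstract ring hypotheses from a tiling. -/
lemma ring_hyps (n a b L : ℕ) (hL : 1 ≤ L) (hn : a + b + L + 2 ≤ n) (S : Set (ℕ × ℕ))
    (f : ℕ × ℕ → ℕ × ℕ) (ht : IsTiling n S f)
    (him : f '' RingDown a b (L + 2) = RingUp a b (L + 2)) :
    (∀ i j, RD a b L i j → f (i, j) = (i, j) ∨ f (i, j) = (i + 1, j) ∨ f (i, j) = (i, j + 1)) ∧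
    (∀ i j u v, RD a b L i j → f (i, j) = (u, v) → RU a b L u v) ∧
    (∀ i j i' j', RD a b L i j → RD a b L i' j' → f (i, j) = f (i', j') → i = i' ∧ j = j') := by
  have hd : ∀ i j, RD a b L i j → (i, j) ∈ DownTri n := by
    intro i j h
    simp only [DownTri, Set.mem_ofPred_eq]
    unfold RD at h; omega
  refine ⟨fun i j h => ht.2 _ (hd i j h), ?_, ?_⟩
  · intro i j u v h e
    rw [← mem_ringUp a b L u v hL, ← him, ← e]
    exact ⟨_, (mem_ringDown a b L i j hL).2 h, rfl⟩
  · intro i j i' j' h h' e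
    have := ht.1.injOn (hd _ _ h) (hd _ _ h') e
    simpa using this

/-- A GD flip preserves the number of rhombi of each of the three
orientations, and strictly increases the sum of `2i + j` over the vertical rhombi
(the downward triangles `d = (i,j)` with `f d = (i, j+1)`). -/
theorem gd_flip_orientations_and_weight (n : ℕ) (f g : ℕ × ℕ → ℕ × ℕ)
    (hflip : GDFlip n f g) :
    (∀ t ∈ ({(0, 0), (1, 0), (0, 1)} : Finset (ℕ × ℕ)),
      ((downFinset n).filter (fun d => g d = (d.1 + t.1, d.2 + t.2))).card =
        ((downFinset n).filter (fun d => f d = (d.1 + t.1, d.2 + t.2))).card) ∧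
    ((downFinset n).filter (fun d => f d = (d.1, d.2 + 1))).sum (fun d => 2 * d.1 + d.2) <
      ((downFinset n).filter (fun d => g d = (d.1, d.2 + 1))).sum
        (fun d => 2 * d.1 + d.2) := by
  classical
  obtain ⟨a, b, m, hm, hn, ⟨fim, f0⟩, ⟨gim, g0⟩, ⟨S, tf, tg⟩, hout⟩ := hflip
  obtain ⟨L, rfl⟩ : ∃ L, m = L + 2 := ⟨m - 2, by omega⟩
  have hL : 1 ≤ L := by omega
  obtain ⟨fa, fu, fi⟩ := ring_hyps n a b L hL (by omega) S f tf fim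
  obtain ⟨ga, gu, gi⟩ := ring_hyps n a b L hL (by omega) S g tg gim
  obtain ⟨f1, f2, f3⟩ := cw_forced a b L hL f fa fu fi f0
  obtain ⟨g1, g2, g3⟩ := ccw_forced a b L hL g ga gu gi g0
  -- the common part
  have hcommon : ∀ (t : ℕ × ℕ),
      ((downFinset n).filter (fun d => ¬ RD a b L d.1 d.2)).filter
        (fun d => g d = (d.1 + t.1, d.2 + t.2)) =
      ((downFinset n).filter (fun d => ¬ RD a b L d.1 d.2)).filter
        (fun d => f d = (d.1 + t.1, d.2 + t.2)) := by
    intro t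
    apply Finset.filter_congr
    rintro ⟨i, j⟩ hd
    rw [Finset.mem_filter, mem_downFinset] at hd
    rw [hout (i, j) hd.1 (by rw [mem_ringDown a b L i j hL]; exact hd.2)]
  -- classification of the ring cells
  have fcl : ∀ i j, RD a b L i j →
      (i = a ∧ j < b + L ∧ f (i, j) = (i, j + 1)) ∨
      (i + j = a + b + L ∧ i < a + L ∧ f (i, j) = (i + 1, j)) ∨
      (j = b ∧ a < i ∧ f (i, j) = (i, j)) := by
    intro i j h
    unfold RD at h
    obtain ⟨x, rfl⟩ := Nat.exists_eq_add_of_le h.1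
    obtain ⟨y, rfl⟩ := Nat.exists_eq_add_of_le h.2.1
    by_cases c1 : x = 0 ∧ y < L
    · obtain ⟨rfl, c⟩ := c1
      exact Or.inl ⟨by omega, by omega, f1 y c⟩
    · by_cases c2 : x + y = L ∧ x < L
      · exact Or.inr (Or.inl ⟨by omega, by omega, f2 x y c2.2 c2.1⟩)
      · obtain rfl : y = 0 := by omega
        exact Or.inr (Or.inr ⟨by omega, by omega, f3 (L - x) x (by omega) (by omega)⟩)
  have gcl : ∀ i j, RD a b L i j →
      (j = b ∧ i < a + L ∧ g (i, j) = (i + 1, j)) ∨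
      (i + j = a + b + L ∧ j < b + L ∧ g (i, j) = (i, j + 1)) ∨
      (i = a ∧ b < j ∧ g (i, j) = (i, j)) := by
    intro i j h
    unfold RD at h
    obtain ⟨x, rfl⟩ := Nat.exists_eq_add_of_le h.1
    obtain ⟨y, rfl⟩ := Nat.exists_eq_add_of_le h.2.1
    by_cases c1 : y = 0 ∧ x < L
    · obtain ⟨rfl, c⟩ := c1
      exact Or.inl ⟨by omega, by omega, g1 x c⟩
    · by_cases c2 : x + y = L ∧ y < L
      · exact Or.inr (Or.inl ⟨by omega, by omega, g2 y x c2.2 (by omega)⟩)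
      · obtain rfl : x = 0 := by omega
        exact Or.inr (Or.inr ⟨by omega, by omega, g3 (L - y) y (by omega) (by omega)⟩)
  -- vertical rhombi
  have fV := split_sum (downFinset n) (fun d => f d = (d.1 + 0, d.2 + 1))
    (fun d => RD a b L d.1 d.2) L (fun k => (a, b + k))
    (by intro k _ l _ h; simp only [Prod.mk.injEq] at h; omega)
    (by
      rintro ⟨i, j⟩
      simp only [mem_downFinset, Prod.mk.injEq]
      constructor
      · rintro ⟨_, h, e⟩
        rcases fcl i j h with c | c | c <;> rw [c.2.2] at e <;> simp only [Prod.mk.injEq] at e <;>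
          unfold RD at h <;> exact ⟨j - b, by omega, by omega, by omega⟩
      · rintro ⟨k, hk, rfl, rfl⟩
        exact ⟨by omega, by unfold RD; omega, f1 k hk⟩)
  have gV := split_sum (downFinset n) (fun d => g d = (d.1 + 0, d.2 + 1))
    (fun d => RD a b L d.1 d.2) L (fun k => (a + (L - k), b + k))
    (by intro k _ l _ h; simp only [Prod.mk.injEq] at h; omega)
    (by
      rintro ⟨i, j⟩
      simp only [mem_downFinset, Prod.mk.injEq]
      constructor
      · rintro ⟨_, h, e⟩
        rcases gcl i j h with c | c | c <;> rw [c.2.2] at e <;> simp only [Prod.mk.injEq] at e <;>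
          unfold RD at h <;> exact ⟨j - b, by omega, by omega, by omega⟩
      · rintro ⟨k, hk, rfl, rfl⟩
        exact ⟨by omega, by unfold RD; omega, g2 k (L - k) hk (by omega)⟩)
  have fH := split_sum (downFinset n) (fun d => f d = (d.1 + 1, d.2 + 0))
    (fun d => RD a b L d.1 d.2) L (fun k => (a + k, b + (L - k)))
    (by intro k _ l _ h; simp only [Prod.mk.injEq] at h; omega)
    (by
      rintro ⟨i, j⟩
      simp only [mem_downFinset, Prod.mk.injEq]
      constructor
      · rintro ⟨_, h, e⟩
        rcases fcl i j h with c | c | c <;> rw [c.2.2] at e <;> simp only [Prod.mk.injEq] at e <;>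
          unfold RD at h <;> exact ⟨i - a, by omega, by omega, by omega⟩
      · rintro ⟨k, hk, rfl, rfl⟩
        exact ⟨by omega, by unfold RD; omega, f2 k (L - k) hk (by omega)⟩)
  have gH := split_sum (downFinset n) (fun d => g d = (d.1 + 1, d.2 + 0))
    (fun d => RD a b L d.1 d.2) L (fun k => (a + k, b))
    (by intro k _ l _ h; simp only [Prod.mk.injEq] at h; omega)
    (by
      rintro ⟨i, j⟩
      simp only [mem_downFinset, Prod.mk.injEq]
      constructor
      · rintro ⟨_, h, e⟩
        rcases gcl i j h with c | c | c <;> rw [c.2.2] at e <;> simp only [Prod.mk.injEq] at e <;>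
          unfold RD at h <;> exact ⟨i - a, by omega, by omega, by omega⟩
      · rintro ⟨k, hk, rfl, rfl⟩
        exact ⟨by omega, by unfold RD; omega, g1 k hk⟩)
  have fZ := split_sum (downFinset n) (fun d => f d = (d.1 + 0, d.2 + 0))
    (fun d => RD a b L d.1 d.2) L (fun k => (a + (k + 1), b))
    (by intro k _ l _ h; simp only [Prod.mk.injEq] at h; omega)
    (by
      rintro ⟨i, j⟩
      simp only [mem_downFinset, Prod.mk.injEq]
      constructor
      · rintro ⟨_, h, e⟩
        rcases fcl i j h with c | c | c <;> rw [c.2.2] at e <;> simp only [Prod.mk.injEq] at e <;>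
          unfold RD at h <;> exact ⟨i - a - 1, by omega, by omega, by omega⟩
      · rintro ⟨k, hk, rfl, rfl⟩
        exact ⟨by omega, by unfold RD; omega, f3 (L - (k + 1)) (k + 1) (by omega) (by omega)⟩)
  have gZ := split_sum (downFinset n) (fun d => g d = (d.1 + 0, d.2 + 0))
    (fun d => RD a b L d.1 d.2) L (fun k => (a, b + (k + 1)))
    (by intro k _ l _ h; simp only [Prod.mk.injEq] at h; omega)
    (by
      rintro ⟨i, j⟩
      simp only [mem_downFinset, Prod.mk.injEq]
      constructor
      · rintro ⟨_, h, e⟩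
        rcases gcl i j h with c | c | c <;> rw [c.2.2] at e <;> simp only [Prod.mk.injEq] at e <;>
          unfold RD at h <;> exact ⟨j - b - 1, by omega, by omega, by omega⟩
      · rintro ⟨k, hk, rfl, rfl⟩
        exact ⟨by omega, by unfold RD; omega, g3 (L - (k + 1)) (k + 1) (by omega) (by omega)⟩)
  have c00 := hcommon (0, 0)
  have c10 := hcommon (1, 0)
  have c01 := hcommon (0, 1)
  constructor
  · intro t ht
    simp only [Finset.mem_insert, Finset.mem_singleton] at ht
    simp only [Finset.card_eq_sum_ones]
    rcases ht with rfl | rfl | rfl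
    · exact (gZ _).trans ((congrArg (fun s => s.sum (fun _ => 1) + _) c00).trans (fZ _).symm)
    · exact (gH _).trans ((congrArg (fun s => s.sum (fun _ => 1) + _) c10).trans (fH _).symm)
    · exact (gV _).trans ((congrArg (fun s => s.sum (fun _ => 1) + _) c01).trans (fV _).symm)
  · have e1 := fV (fun d => 2 * d.1 + d.2)
    have e2 := gV (fun d => 2 * d.1 + d.2)
    simp only [] at c01
    rw [c01] at e2
    simp only [Nat.add_zero] at e1 e2
    rw [e1, e2]
    apply Nat.add_lt_add_left
    apply Finset.sum_lt_sum_of_nonempty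
    · exact ⟨0, Finset.mem_range.2 (by omega)⟩
    · intro k hk
      have := Finset.mem_range.1 hk
      omega
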